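/- Let α ∈ (0,2). Let X_1, X_2, … be independent identically distributed real random variables whose common distribution is symmetric about 0 and has a probability density function f satisfying f(u) ≍ u^{-1-α} as u → ∞. For n ∈ ℕ let S_n := X_1 + … + X_n. Then for any sequences (n_k) of positive integers and (x_k) of positive reals with n_k / x_k^α → 0, one has P(S_{n_k} > x_k) ≍ n_k x_k^{-α}; that is, there exist constants 0 < c ≤ C such that c · n_k x_k^{-α} ≤ P(S_{n_k} > x_k) ≤ C · n_k x_k^{-α} for all sufficiently large k. -/

import Mathlib

open MeasureTheory ProbabilityTheory Filter

lemma lintegral_pow_tail {α : ℝ} (hα : 0 < α) {K : ℝ} (hK : 0 ≤ K) {y : ℝ} (hy : 0 < y) :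
    ∫⁻ u in Set.Ioi y, ENNReal.ofReal (K * u ^ (-1 - α)) = ENNReal.ofReal (K / α * y ^ (-α)) := by
  rw [← ofReal_integral_eq_lintegral_ofReal]
  · rw [integral_const_mul, integral_Ioi_rpow_of_lt (by linarith) hy]
    congr 1
    have : (-1 - α + 1) = -α := by ring
    rw [this]
    field_simp
  · exact (integrableOn_Ioi_rpow_of_lt (by linarith) hy).const_mul K
  · filter_upwards [ae_restrict_mem measurableSet_Ioi] with u hu
    have : 0 < u := hy.trans hu
    simp only [Pi.zero_apply]
    positivity

lemma tail_bounds {α : ℝ} (hα : 0 < α) {μ : Measure ℝ} {f : ℝ → ℝ}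
    (hpdf : μ = (volume : Measure ℝ).withDensity (fun u => ENNReal.ofReal (f u)))
    [IsProbabilityMeasure μ]
    {k0 K0 u0 : ℝ} (hk0 : 0 < k0) (hK0 : k0 ≤ K0) (hu0 : 0 < u0)
    (htail : ∀ u, u0 ≤ u → k0 * u ^ (-1 - α) ≤ f u ∧ f u ≤ K0 * u ^ (-1 - α))
    {y : ℝ} (hy : u0 ≤ y) :
    k0 / α * y ^ (-α) ≤ μ.real (Set.Ioi y) ∧ μ.real (Set.Ioi y) ≤ K0 / α * y ^ (-α) := by
  have hy0 : 0 < y := hu0.trans_le hy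
  have hK : 0 < K0 := hk0.trans_le hK0
  have e : μ (Set.Ioi y) = ∫⁻ u in Set.Ioi y, ENNReal.ofReal (f u) := by
    rw [hpdf, withDensity_apply _ measurableSet_Ioi]
  constructor
  · rw [measureReal_def, ← ENNReal.ofReal_le_iff_le_toReal (measure_ne_top _ _), e,
      ← lintegral_pow_tail hα hk0.le hy0]
    refine setLIntegral_mono' measurableSet_Ioi fun u hu => ?_
    exact ENNReal.ofReal_le_ofReal (htail u (hy.trans (le_of_lt hu))).1
  · refine ENNReal.toReal_le_of_le_ofReal (by positivity) ?_
    rw [e, ← lintegral_pow_tail hα hK.le hy0]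
    refine setLIntegral_mono' measurableSet_Ioi fun u hu => ?_
    exact ENNReal.ofReal_le_ofReal (htail u (hy.trans (le_of_lt hu))).2

/-- truncation at level x -/
noncomputable def trunc (x u : ℝ) : ℝ := if |u| ≤ x then u else 0

lemma measurable_trunc (x : ℝ) : Measurable (trunc x) := by
  unfold trunc
  exact Measurable.ite (measurableSet_le (by fun_prop) measurable_const) measurable_id measurable_const

lemma abs_trunc_le {x : ℝ} (hx : 0 ≤ x) (u : ℝ) : |trunc x u| ≤ x := by
  unfold trunc
  split_ifs with h
  · exact h
  · simpa

lemma integral_trunc {μ : Measure ℝ} (hsymm : μ.map (fun u => -u) = μ) (x : ℝ) :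
    ∫ u, trunc x u ∂μ = 0 := by
  have h : ∫ u, trunc x u ∂μ = ∫ u, trunc x (-u) ∂μ := by
    conv_lhs => rw [← hsymm]
    rw [integral_map (by fun_prop) (measurable_trunc x).aestronglyMeasurable]
  have h2 : ∀ u, trunc x (-u) = - trunc x u := by
    intro u; unfold trunc; simp only [abs_neg]; split_ifs <;> simp
  simp only [h2, integral_neg] at h
  linarith

lemma integral_trunc_sq {α : ℝ} (hα : α < 2) {μ : Measure ℝ} {f : ℝ → ℝ}
    (hfmeas : Measurable f)
    (hpdf : μ = (volume : Measure ℝ).withDensity (fun u => ENNReal.ofReal (f u)))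
    [IsProbabilityMeasure μ] (hsymm : μ.map (fun u => -u) = μ)
    {K0 u0 : ℝ} (hK0 : 0 < K0) (hu0 : 0 < u0)
    (htail : ∀ u, u0 ≤ u → f u ≤ K0 * u ^ (-1 - α))
    {x : ℝ} (hx : u0 ≤ x) :
    ∫ u, (trunc x u) ^ 2 ∂μ ≤ (u0 ^ α + 2 * (K0 / (2 - α))) * x ^ (2 - α) := by
  have hx0 : 0 < x := hu0.trans_le hx
  have h2 : 0 < 2 - α := by linarith
  set G : ℝ → ENNReal := (Set.Ioc u0 x).indicator (fun u => ENNReal.ofReal (u ^ 2)) with hG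
  have hGm : Measurable G := Measurable.indicator (by fun_prop) measurableSet_Ioc
  have hGint : ∫⁻ u, G u ∂μ ≤ ENNReal.ofReal (K0 / (2 - α) * x ^ (2 - α)) := by
    rw [hpdf, lintegral_withDensity_eq_lintegral_mul _ (by fun_prop) hGm]
    have e1 : (fun u => ((fun u => ENNReal.ofReal (f u)) * G) u) =
        (Set.Ioc u0 x).indicator (fun u => ENNReal.ofReal (f u) * ENNReal.ofReal (u ^ 2)) := by
      ext u
      simp only [Pi.mul_apply, hG, Set.indicator]
      split_ifs <;> simp
    rw [e1, lintegral_indicator measurableSet_Ioc]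
    have e2 : ∫⁻ u in Set.Ioc u0 x, ENNReal.ofReal (f u) * ENNReal.ofReal (u ^ 2) ≤
        ∫⁻ u in Set.Ioc u0 x, ENNReal.ofReal (K0 * u ^ (1 - α)) := by
      refine setLIntegral_mono' measurableSet_Ioc fun u hu => ?_
      rw [← ENNReal.ofReal_mul' (by positivity)]
      refine ENNReal.ofReal_le_ofReal ?_
      have hu' : 0 < u := hu0.trans hu.1
      have := htail u hu.1.le
      have e3 : u ^ (1 - α) = u ^ (-1 - α) * u ^ 2 := by
        rw [← Real.rpow_natCast, ← Real.rpow_add hu']; congr 1; push_cast; ring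
      rw [e3, ← mul_assoc]
      gcongr
    refine e2.trans ?_
    rw [← ofReal_integral_eq_lintegral_ofReal]
    · rw [integral_const_mul, ← intervalIntegral.integral_of_le hx, integral_rpow (Or.inl (by linarith))]
      refine ENNReal.ofReal_le_ofReal ?_
      have : 1 - α + 1 = 2 - α := by ring
      rw [this, div_mul_eq_mul_div, mul_div_assoc]
      have := Real.rpow_nonneg hu0.le (2 - α)
      gcongr
      linarith
    · refine Integrable.const_mul ?_ K0
      have := intervalIntegral.intervalIntegrable_rpow (μ := volume) (a := u0) (b := x) (r := 1 - α)
        (Or.inr (by rw [Set.uIcc_of_le hx]; intro h; linarith [h.1]))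
      exact (intervalIntegrable_iff_integrableOn_Ioc_of_le hx).1 this
    · filter_upwards [ae_restrict_mem measurableSet_Ioc] with u hu
      have : 0 < u := hu0.trans hu.1
      simp only [Pi.zero_apply]
      positivity
  have hGneg : ∫⁻ u, G (-u) ∂μ = ∫⁻ u, G u ∂μ := by
    conv_rhs => rw [← hsymm]
    rw [lintegral_map hGm (by fun_prop)]
  have hpt : ∀ u, ENNReal.ofReal ((trunc x u) ^ 2) ≤ ENNReal.ofReal (u0 ^ 2) + (G u + G (-u)) := by
    intro u
    unfold trunc
    split_ifs with h
    · by_cases h1 : |u| ≤ u0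
      · refine le_trans (ENNReal.ofReal_le_ofReal ?_) le_self_add
        exact sq_le_sq' (by linarith [neg_abs_le u]) ((le_abs_self u).trans h1)
      · push Not at h1
        refine le_trans ?_ le_add_self
        rcases le_total 0 u with hu | hu
        · rw [abs_of_nonneg hu] at h h1
          refine le_trans ?_ le_self_add
          rw [hG, Set.indicator_of_mem (show u ∈ Set.Ioc u0 x from ⟨h1, h⟩)]
        · rw [abs_of_nonpos hu] at h h1
          refine le_trans ?_ le_add_self
          rw [hG, Set.indicator_of_mem (show -u ∈ Set.Ioc u0 x from ⟨h1, h⟩), neg_sq]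
    · simp
  rw [integral_eq_lintegral_of_nonneg_ae (Eventually.of_forall fun u => sq_nonneg _)
    ((measurable_trunc x).pow_const 2).aestronglyMeasurable]
  refine ENNReal.toReal_le_of_le_ofReal (by positivity) ?_
  refine (lintegral_mono hpt).trans ?_
  rw [lintegral_add_left measurable_const, lintegral_add_left hGm, hGneg]
  simp only [lintegral_const, measure_univ, mul_one]
  calc _ ≤ ENNReal.ofReal (u0 ^ 2) + (ENNReal.ofReal (K0 / (2 - α) * x ^ (2 - α)) +
        ENNReal.ofReal (K0 / (2 - α) * x ^ (2 - α))) := by gcongr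
    _ = ENNReal.ofReal (u0 ^ 2 + (K0 / (2 - α) * x ^ (2 - α) + K0 / (2 - α) * x ^ (2 - α))) := by
      rw [ENNReal.ofReal_add, ENNReal.ofReal_add] <;> positivity
    _ ≤ _ := by
      refine ENNReal.ofReal_le_ofReal ?_
      have e4 : u0 ^ 2 = u0 ^ α * u0 ^ (2 - α) := by
        rw [← Real.rpow_natCast, ← Real.rpow_add hu0]; congr 1; push_cast; ring
      have e5 : u0 ^ α * u0 ^ (2 - α) ≤ u0 ^ α * x ^ (2 - α) := by gcongr
      rw [e4]; linarith

lemma abs_tail {μ : Measure ℝ} [IsProbabilityMeasure μ] (hsymm : μ.map (fun u => -u) = μ) (x : ℝ) :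
    μ.real {u | x < |u|} ≤ 2 * μ.real (Set.Ioi x) := by
  have h1 : {u : ℝ | x < |u|} ⊆ Set.Ioi x ∪ (fun u => -u) ⁻¹' (Set.Ioi x) := by
    intro u hu
    have hu : x < |u| := hu
    rcases lt_abs.1 hu with h | h
    · exact Or.inl h
    · exact Or.inr h
  have h2 : μ.real ((fun u => -u) ⁻¹' (Set.Ioi x)) = μ.real (Set.Ioi x) := by
    conv_rhs => rw [← hsymm]
    rw [measureReal_def, measureReal_def, Measure.map_apply (by fun_prop) measurableSet_Ioi]
  have h3 := measureReal_mono (μ := μ) h1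
  have h4 := measureReal_union_le (μ := μ) (Set.Ioi x) ((fun u => -u) ⁻¹' (Set.Ioi x))
  linarith

lemma sum_upper {Ω : Type*} [MeasurableSpace Ω] {P : Measure Ω} [IsProbabilityMeasure P]
    {X : ℕ → Ω → ℝ} (hmeas : ∀ i, Measurable (X i)) (hindep : iIndepFun X P)
    {μ : Measure ℝ} [IsProbabilityMeasure μ] (hlaw : ∀ i, P.map (X i) = μ)
    (hsymm : μ.map (fun u => -u) = μ) {x V : ℝ} (hx : 0 < x)
    (hV : ∫ u, (trunc x u) ^ 2 ∂μ ≤ V) (s : Finset ℕ) :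
    P.real {ω | x ≤ |∑ i ∈ s, X i ω|} ≤ s.card * (2 * μ.real (Set.Ioi x) + V / x ^ 2) := by
  set Y : ℕ → Ω → ℝ := fun i ω => trunc x (X i ω) with hY
  have hYm : ∀ i, Measurable (Y i) := fun i => (measurable_trunc x).comp (hmeas i)
  have hYL : ∀ i, MemLp (Y i) 2 P := fun i =>
    MemLp.of_bound (hYm i).aestronglyMeasurable x
      (Eventually.of_forall fun ω => abs_trunc_le hx.le _)
  have hYE : ∀ i, ∫ ω, Y i ω ∂P = 0 := fun i => by
    rw [← integral_trunc hsymm x, ← hlaw i,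
      integral_map (hmeas i).aemeasurable (measurable_trunc x).aestronglyMeasurable]
  have hYV : ∀ i, Var[Y i; P] ≤ V := fun i => by
    refine (variance_le_expectation_sq (hYm i).aestronglyMeasurable).trans ?_
    refine le_trans (le_of_eq ?_) hV
    rw [← hlaw i, integral_map (hmeas i).aemeasurable
      ((measurable_trunc x).pow_const 2).aestronglyMeasurable]
    rfl
  have hVar : Var[∑ i ∈ s, Y i; P] ≤ s.card * V := by
    rw [IndepFun.variance_sum (fun i _ => hYL i)]
    · refine (Finset.sum_le_sum fun i _ => hYV i).trans ?_
      simp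
    · intro i _ j _ hij
      exact (hindep.indepFun hij).comp (measurable_trunc x) (measurable_trunc x)
  have hE : ∫ ω, (∑ i ∈ s, Y i) ω ∂P = 0 := by
    simp only [Finset.sum_apply]
    rw [integral_finsetSum _ (fun i _ => (hYL i).integrable (by norm_num))]
    simp [hYE]
  have hCheb : P.real {ω | x ≤ |(∑ i ∈ s, Y i) ω|} ≤ s.card * (V / x ^ 2) := by
    have h := meas_ge_le_variance_div_sq (μ := P) (X := ∑ i ∈ s, Y i)
      (memLp_finsetSum' _ fun i _ => hYL i) hx
    rw [hE] at h
    simp only [sub_zero] at h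
    have h' := ENNReal.toReal_le_of_le_ofReal (by have := variance_nonneg (∑ i ∈ s, Y i) P; positivity) h
    refine h'.trans ?_
    rw [← mul_div_assoc]
    gcongr
  have hsub : {ω | x ≤ |∑ i ∈ s, X i ω|} ⊆
      (⋃ i ∈ s, X i ⁻¹' {u | x < |u|}) ∪ {ω | x ≤ |(∑ i ∈ s, Y i) ω|} := by
    intro ω hω
    by_cases h : ∃ i ∈ s, x < |X i ω|
    · left
      simpa using h
    · right
      push Not at h
      have : (∑ i ∈ s, Y i) ω = ∑ i ∈ s, X i ω := by
        rw [Finset.sum_apply]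
        refine Finset.sum_congr rfl fun i hi => ?_
        simp [hY, trunc, h i hi]
      change x ≤ |(∑ i ∈ s, Y i) ω|
      rw [this]
      exact hω
  have hms : MeasurableSet {u : ℝ | x < |u|} := measurableSet_lt measurable_const (by fun_prop)
  have hU : P.real (⋃ i ∈ s, X i ⁻¹' {u | x < |u|}) ≤ s.card * (2 * μ.real (Set.Ioi x)) := by
    refine (measureReal_biUnion_finset_le _ _).trans ?_
    refine (Finset.sum_le_sum (g := fun _ => 2 * μ.real (Set.Ioi x)) fun i _ => ?_).trans (by simp)
    refine le_trans (le_of_eq ?_) (abs_tail hsymm x)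
    rw [← hlaw i, measureReal_def, measureReal_def, Measure.map_apply (hmeas i) hms]
  have h3 := measureReal_mono (μ := P) hsub
  have h4 := measureReal_union_le (μ := P) (⋃ i ∈ s, X i ⁻¹' {u | x < |u|})
    {ω | x ≤ |(∑ i ∈ s, Y i) ω|}
  linarith

lemma sum_lower {Ω : Type*} [MeasurableSpace Ω] {P : Measure Ω} [IsProbabilityMeasure P]
    {X : ℕ → Ω → ℝ} (hmeas : ∀ i, Measurable (X i)) (hindep : iIndepFun X P)
    {μ : Measure ℝ} [IsProbabilityMeasure μ] (hlaw : ∀ i, P.map (X i) = μ)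
    {x B : ℝ} (s : Finset ℕ)
    (hB : ∀ i ∈ s, P.real {ω | x ≤ |∑ j ∈ s.erase i, X j ω|} ≤ B)
    (hsm : B + s.card * μ.real (Set.Ioi (2 * x)) ≤ 1 / 2) :
    1 / 2 * (s.card * μ.real (Set.Ioi (2 * x))) ≤ P.real {ω | ∑ i ∈ s, X i ω > x} := by
  set p := μ.real (Set.Ioi (2 * x)) with hp
  have hpi : ∀ i, P.real (X i ⁻¹' Set.Ioi (2 * x)) = p := fun i => by
    rw [hp, ← hlaw i, measureReal_def, measureReal_def, Measure.map_apply (hmeas i) measurableSet_Ioi]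
  have hp0 : 0 ≤ p := measureReal_nonneg
  set D : ℕ → Set Ω := fun i => {ω | |∑ j ∈ s.erase i, X j ω| < x ∧ ∀ j ∈ s.erase i, X j ω ≤ 2 * x}
    with hD
  have hDm : ∀ i, MeasurableSet (D i) := fun i => by
    refine MeasurableSet.inter (s₁ := {ω | |∑ j ∈ s.erase i, X j ω| < x})
      (s₂ := {ω | ∀ j ∈ s.erase i, X j ω ≤ 2 * x})
      (measurableSet_lt (by fun_prop) measurable_const) ?_
    have : {ω | ∀ j ∈ s.erase i, X j ω ≤ 2 * x} = ⋂ j ∈ s.erase i, {ω | X j ω ≤ 2 * x} := by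
      ext; simp
    change MeasurableSet {ω | ∀ j ∈ s.erase i, X j ω ≤ 2 * x}
    rw [this]
    exact Finset.measurableSet_biInter _ fun j _ => measurableSet_le (hmeas j) measurable_const
  have hDp : ∀ i ∈ s, 1 / 2 ≤ P.real (D i) := fun i hi => by
    have hc : (D i)ᶜ ⊆ {ω | x ≤ |∑ j ∈ s.erase i, X j ω|} ∪ ⋃ j ∈ s.erase i, X j ⁻¹' Set.Ioi (2 * x) := by
      intro ω hω
      by_cases h : x ≤ |∑ j ∈ s.erase i, X j ω|
      · exact Or.inl h
      · right
        push Not at h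
        by_contra h'
        simp only [Set.mem_iUnion, not_exists, Set.mem_preimage, Set.mem_Ioi, not_lt] at h'
        exact hω ⟨h, h'⟩
    have h1 := measureReal_mono (μ := P) hc
    have h2 := measureReal_union_le (μ := P) {ω | x ≤ |∑ j ∈ s.erase i, X j ω|}
      (⋃ j ∈ s.erase i, X j ⁻¹' Set.Ioi (2 * x))
    have h3 := measureReal_biUnion_finset_le (μ := P) (s.erase i) (fun j => X j ⁻¹' Set.Ioi (2 * x))
    simp only [hpi, Finset.sum_const, nsmul_eq_mul] at h3
    have h4 : ((s.erase i).card : ℝ) * p ≤ s.card * p := by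
      gcongr; exact Finset.erase_subset _ _
    have h5 := probReal_compl_eq_one_sub (μ := P) (hDm i)
    have h6 := hB i hi
    linarith
  have hind : ∀ i, P.real (X i ⁻¹' Set.Ioi (2 * x) ∩ D i) = p * P.real (D i) := fun i => by
    have h := hindep.indepFun_finset {i} (s.erase i) (by simp) hmeas
    let T : Finset ℕ := s.erase i
    let A : Set (({i} : Finset ℕ) → ℝ) := {v | 2 * x < v ⟨i, by simp⟩}
    let C : Set (T → ℝ) := {v | |∑ j, v j| < x ∧ ∀ j, v j ≤ 2 * x}
    have hA : MeasurableSet A := measurableSet_lt measurable_const (measurable_pi_apply _)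
    have hC : MeasurableSet C := by
      refine MeasurableSet.inter (s₁ := {v : T → ℝ | |∑ j, v j| < x})
        (s₂ := {v : T → ℝ | ∀ j, v j ≤ 2 * x})
        (measurableSet_lt (by fun_prop) measurable_const) ?_
      change MeasurableSet {v : T → ℝ | ∀ j, v j ≤ 2 * x}
      rw [Set.setOf_forall]
      exact MeasurableSet.iInter fun j => measurableSet_le (measurable_pi_apply j) measurable_const
    have h' := h.measure_inter_preimage_eq_mul A C hA hC
    have eC : (fun ω (j : T) => X j ω) ⁻¹' C = D i := by
      ext ω
      simp only [C, hD, Set.mem_preimage, Set.mem_ofPred_eq]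
      rw [Finset.sum_coe_sort T (fun j => X j ω)]
      simp only [Subtype.forall]
      rfl
    have eA : (fun ω (j : ({i} : Finset ℕ)) => X j ω) ⁻¹' A = X i ⁻¹' Set.Ioi (2 * x) := rfl
    rw [eC, eA] at h'
    rw [measureReal_def, h', ENNReal.toReal_mul, ← measureReal_def, ← measureReal_def, hpi]
  have hdisj : (s : Set ℕ).PairwiseDisjoint (fun i => X i ⁻¹' Set.Ioi (2 * x) ∩ D i) := by
    intro i hi j hj hij
    refine Set.disjoint_left.2 fun ω h1 h2 => ?_
    have h3 : 2 * x < X i ω := h1.1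
    have h4 := h2.2.2 i (Finset.mem_erase.2 ⟨hij, hi⟩)
    linarith
  have hsub : (⋃ i ∈ s, X i ⁻¹' Set.Ioi (2 * x) ∩ D i) ⊆ {ω | ∑ i ∈ s, X i ω > x} := by
    intro ω hω
    simp only [Set.mem_iUnion] at hω
    obtain ⟨i, hi, h1, h2⟩ := hω
    have h1 : 2 * x < X i ω := h1
    have h3 := (abs_lt.1 h2.1).1
    have h4 := Finset.add_sum_erase s (fun j => X j ω) hi
    simp only [Set.mem_ofPred_eq, gt_iff_lt] at h4 ⊢
    linarith
  have hfin := measureReal_mono (μ := P) hsub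
  rw [measureReal_biUnion_finset hdisj (fun i _ => (hmeas i measurableSet_Ioi).inter (hDm i))] at hfin
  refine le_trans ?_ hfin
  calc 1 / 2 * (s.card * p) = ∑ i ∈ s, p * (1 / 2) := by simp; ring
    _ ≤ _ := Finset.sum_le_sum fun i hi => by rw [hind]; gcongr; exact hDp i hi

theorem large_deviation_asymp
    {Ω : Type*} [MeasureSpace Ω] [IsProbabilityMeasure (ℙ : Measure Ω)]
    (α : ℝ) (hα : α ∈ Set.Ioo (0 : ℝ) 2)
    (X : ℕ → Ω → ℝ) (hmeas : ∀ i, Measurable (X i))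
    (hindep : iIndepFun X ℙ)
    (hident : ∀ i, IdentDistrib (X i) (X 0) ℙ ℙ)
    (hsymm : Measure.map (X 0) ℙ = Measure.map (fun ω => -(X 0 ω)) ℙ)
    (f : ℝ → ℝ) (hf0 : ∀ u, 0 ≤ f u) (hfmeas : Measurable f)
    (hpdf : Measure.map (X 0) ℙ = (volume : Measure ℝ).withDensity (fun u => ENNReal.ofReal (f u)))
    (k0 K0 u0 : ℝ) (hk0 : 0 < k0) (hK0 : k0 ≤ K0) (hu0 : 0 < u0)
    (htail : ∀ u, u0 ≤ u → k0 * u ^ (-1 - α) ≤ f u ∧ f u ≤ K0 * u ^ (-1 - α))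
    (n : ℕ → ℕ) (hn : ∀ k, 0 < n k)
    (x : ℕ → ℝ) (hx : ∀ k, 0 < x k)
    (hLD : Tendsto (fun k => (n k : ℝ) / x k ^ α) atTop (nhds 0))
:
    ∃ c C : ℝ, 0 < c ∧ c ≤ C ∧
      ∀ᶠ k in atTop,
        c * ((n k : ℝ) * x k ^ (-α)) ≤ (ℙ {ω | (∑ i ∈ Finset.range (n k), X i ω) > x k}).toReal ∧
        (ℙ {ω | (∑ i ∈ Finset.range (n k), X i ω) > x k}).toReal ≤ C * ((n k : ℝ) * x k ^ (-α)) := by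
  obtain ⟨hα0, hα2⟩ := hα
  have hK : 0 < K0 := hk0.trans_le hK0
  have h2α : 0 < 2 - α := by linarith
  set μ : Measure ℝ := Measure.map (X 0) ℙ with hμ
  have : IsProbabilityMeasure μ := Measure.isProbabilityMeasure_map (hmeas 0).aemeasurable
  have hlaw : ∀ i, Measure.map (X i) ℙ = μ := fun i => (hident i).map_eq
  have hs : μ.map (fun u => -u) = μ := by
    rw [hμ, Measure.map_map (by fun_prop) (hmeas 0)]
    exact hsymm.symm
  set V := u0 ^ α + 2 * (K0 / (2 - α)) with hV
  set C := 2 * (K0 / α) + V with hC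
  set c := 1 / 2 * (k0 / α * 2 ^ (-α)) with hc
  have hV0 : 0 < V := by positivity
  have hKα : 0 < K0 / α := by positivity
  have hup : ∀ (y : ℝ), u0 ≤ y → ∀ s : Finset ℕ,
      (ℙ : Measure Ω).real {ω | y ≤ |∑ i ∈ s, X i ω|} ≤ C * (s.card * y ^ (-α)) := by
    intro y hy s
    have hy0 : 0 < y := hu0.trans_le hy
    have h1 := sum_upper hmeas hindep hlaw hs hy0
      (integral_trunc_sq hα2 hfmeas hpdf hs hK hu0 (fun u hu => (htail u hu).2) hy) s
    have h2 := (tail_bounds hα0 hpdf hk0 hK0 hu0 htail hy).2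
    refine h1.trans ?_
    have h3 : (V * y ^ (2 - α)) / y ^ 2 = V * y ^ (-α) := by
      have : y ^ (2 - α) = y ^ (-α) * y ^ 2 := by
        rw [← Real.rpow_natCast, ← Real.rpow_add hy0]; congr 1; push_cast; ring
      rw [this]; field_simp
    rw [h3]
    calc _ ≤ (s.card : ℝ) * (2 * (K0 / α * y ^ (-α)) + V * y ^ (-α)) := by gcongr
      _ = _ := by rw [hC]; ring
  have hcC : c ≤ C := by
    have h1 : (2 : ℝ) ^ (-α) ≤ 1 := Real.rpow_le_one_of_one_le_of_nonpos (by norm_num) (by linarith)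
    have h2 : k0 / α ≤ K0 / α := by gcongr
    have h3 : k0 / α * 2 ^ (-α) ≤ K0 / α * 1 := by gcongr
    rw [hc, hC]; linarith
  refine ⟨c, C, by positivity, hcC, ?_⟩
  have hxn : ∀ k, (n k : ℝ) / x k ^ α = n k * x k ^ (-α) := fun k => by
    rw [Real.rpow_neg (hx k).le, div_eq_mul_inv]
  have hsmall : ∀ᶠ k in atTop, (n k : ℝ) * x k ^ (-α) < 1 / (2 * (C + K0 / α)) := by
    have := hLD.eventually_lt_const (show (0 : ℝ) < 1 / (2 * (C + K0 / α)) by positivity)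
    simpa only [hxn] using this
  have hbig : ∀ᶠ k in atTop, (n k : ℝ) * x k ^ (-α) < u0 ^ (-α) := by
    have := hLD.eventually_lt_const (show (0 : ℝ) < u0 ^ (-α) by positivity)
    simpa only [hxn] using this
  filter_upwards [hsmall, hbig] with k hk1 hk2
  have hxk := hx k
  have hn1 : (1 : ℝ) ≤ n k := by exact_mod_cast hn k
  have hxα : 0 < x k ^ (-α) := by positivity
  have hxu : u0 ≤ x k := by
    by_contra h
    push Not at h
    have h1 : u0 ^ (-α) ≤ x k ^ (-α) := Real.rpow_le_rpow_of_nonpos hxk h.le (by linarith)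
    nlinarith
  have htb := tail_bounds hα0 hpdf hk0 hK0 hu0 htail (y := 2 * x k) (by linarith)
  have h2x : (2 * x k) ^ (-α) = 2 ^ (-α) * x k ^ (-α) := Real.mul_rpow (by norm_num) hxk.le
  have h2le : (2 : ℝ) ^ (-α) ≤ 1 := Real.rpow_le_one_of_one_le_of_nonpos (by norm_num) (by linarith)
  constructor
  · have h := sum_lower hmeas hindep hlaw (x := x k) (B := C * (n k * x k ^ (-α)))
      (Finset.range (n k)) ?_ ?_
    · refine le_trans ?_ h
      rw [Finset.card_range]
      have := htb.1
      rw [h2x] at this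
      calc c * (n k * x k ^ (-α)) = 1 / 2 * (n k * (k0 / α * (2 ^ (-α) * x k ^ (-α)))) := by
            rw [hc]; ring
        _ ≤ _ := by gcongr
    · intro i hi
      refine (hup _ hxu _).trans ?_
      have : (((Finset.range (n k)).erase i).card : ℝ) ≤ n k := by
        exact_mod_cast (Finset.card_le_card (Finset.erase_subset i _)).trans (by simp)
      gcongr
    · rw [Finset.card_range]
      have h1 : μ.real (Set.Ioi (2 * x k)) ≤ K0 / α * x k ^ (-α) := by
        refine htb.2.trans ?_
        rw [h2x]
        gcongr
        exact mul_le_of_le_one_left hxα.le h2le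
      have h2 : (n k : ℝ) * μ.real (Set.Ioi (2 * x k)) ≤ n k * (K0 / α * x k ^ (-α)) := by gcongr
      rw [lt_div_iff₀ (by positivity)] at hk1
      linarith
  · have h := hup _ hxu (Finset.range (n k))
    rw [Finset.card_range] at h
    refine le_trans ?_ h
    refine measureReal_mono (μ := (ℙ : Measure Ω)) ?_
    intro ω hω
    have hω' : x k < ∑ i ∈ Finset.range (n k), X i ω := hω
    exact hω'.le.trans (le_abs_self _)
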